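/- arXiv:1705.10227 — 3 statements merged into one kernel-verified Lean document; each statement's English description precedes it below -/
import Mathlib

section
/- For any f ∈ ℝ, γ > 0, δ > 0, and any two points X₁ = (v₁, w₁), X₂ = (v₂, w₂) in ℝ², the FitzHugh–Nagumo drift G(v, w) := (p(v) − w + f, γ·v − δ·w) satisfies the one-sided Lipschitz estimate ⟨G(X₁) − G(X₂), X₁ − X₂⟩_γ ≤ η·γ·(v₁ − v₂)² − δ·(w₁ − w₂)² ≤ η·⟨X₁ − X₂, X₁ − X₂⟩_γ, where η = (a² − a·b + b²)/3 and ⟨(v,w),(v′,w′)⟩_γ := γ·v·v′ + w·w′. -/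
/-- The finite-dimensional FitzHugh–Nagumo drift `G (v, w) = (p v - w + f, γ v - δ w)`
satisfies the one-sided Lipschitz estimate
`⟨G X₁ - G X₂, X₁ - X₂⟩_γ ≤ η γ (v₁ - v₂)² - δ (w₁ - w₂)² ≤ η ⟨X₁ - X₂, X₁ - X₂⟩_γ`
for the weighted inner product `⟨(v,w),(v',w')⟩_γ = γ v v' + w w'`. -/
theorem fhn_drift_one_sided_lipschitz (a b f γ δ : ℝ) (hγ : 0 < γ) (hδ : 0 < δ)
    (p : ℝ → ℝ) (hp : ∀ v : ℝ, p v = -v * (v - a) * (v - b))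
    (η : ℝ) (hη : η = (a ^ 2 - a * b + b ^ 2) / 3)
    (v₁ w₁ v₂ w₂ : ℝ) :
    γ * (((p v₁ - w₁ + f) - (p v₂ - w₂ + f)) * (v₁ - v₂))
        + ((γ * v₁ - δ * w₁) - (γ * v₂ - δ * w₂)) * (w₁ - w₂)
      ≤ η * γ * (v₁ - v₂) ^ 2 - δ * (w₁ - w₂) ^ 2 ∧
    η * γ * (v₁ - v₂) ^ 2 - δ * (w₁ - w₂) ^ 2
      ≤ η * (γ * ((v₁ - v₂) * (v₁ - v₂)) + (w₁ - w₂) * (w₁ - w₂)) := by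
  have hη0 : 0 ≤ η := by
    rw [hη]
    nlinarith [sq_nonneg (a - b), sq_nonneg a, sq_nonneg b]
  constructor
  · have key : 0 ≤ γ * (v₁ - v₂) ^ 2 *
        (3 / 4 * (v₁ + v₂ - 2 * (a + b) / 3) ^ 2 + (v₁ - v₂) ^ 2 / 4) := by positivity
    rw [hp, hp, hη]
    linarith [key]
  · have h1 : 0 ≤ η * (w₁ - w₂) ^ 2 := by positivity
    have h2 : 0 ≤ δ * (w₁ - w₂) ^ 2 := by positivity
    linarith [h1, h2]
end

section
/- For all measurable v₁, v₂ : O → ℝ with ∫ |v₁|⁶ dμ < ∞ and ∫ |v₂|⁶ dμ < ∞, the function (p∘v₁ − p∘v₂)·(v₁ − v₂) is μ-integrable and ∫ (p(v₁(ξ)) − p(v₂(ξ)))·(v₁(ξ) − v₂(ξ)) dμ(ξ) ≤ η·∫ (v₁(ξ) − v₂(ξ))² dμ(ξ), where η = (a² − a·b + b²)/3. That is, the Nemytskii operator of p is η-quasi-dissipative on L²(O, μ) along L⁶ functions. -/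
open MeasureTheory

theorem fhn_int_pow {O : Type*} [MeasurableSpace O] (μ : Measure O) [IsFiniteMeasure μ]
    (v : O → ℝ) (hv : Measurable v) (h : Integrable (fun ξ => |v ξ| ^ 6) μ) :
    Integrable (fun ξ => v ξ ^ 2) μ ∧ Integrable (fun ξ => v ξ ^ 4) μ ∧
      Integrable (fun ξ => v ξ ^ 6) μ := by
  have h6 : Integrable (fun ξ => v ξ ^ 6) μ := by
    refine h.congr (Filter.Eventually.of_forall fun ξ => ?_)
    exact Even.pow_abs (by decide) _
  have hc : Integrable (fun ξ => 1 + v ξ ^ 6) μ := (integrable_const 1).add h6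
  refine ⟨?_, ?_, h6⟩
  · refine hc.mono' (hv.pow_const 2).aestronglyMeasurable (Filter.Eventually.of_forall fun ξ => ?_)
    have ht := sq_nonneg (v ξ)
    rw [Real.norm_of_nonneg ht]
    have e : v ξ ^ 6 = (v ξ ^ 2) ^ 3 := by ring
    rw [e]
    generalize v ξ ^ 2 = t at *
    nlinarith [mul_nonneg ht (sq_nonneg (t - 1)), sq_nonneg (t - 1)]
  · refine hc.mono' (hv.pow_const 4).aestronglyMeasurable (Filter.Eventually.of_forall fun ξ => ?_)
    have ht := sq_nonneg (v ξ)
    have e : v ξ ^ 6 = (v ξ ^ 2) ^ 3 := by ring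
    have e4 : v ξ ^ 4 = (v ξ ^ 2) ^ 2 := by ring
    rw [e, e4, Real.norm_of_nonneg (sq_nonneg _)]
    generalize v ξ ^ 2 = t at *
    nlinarith [mul_nonneg ht (sq_nonneg (t - 1)), sq_nonneg (t - 1)]

theorem fhn_sq_bound (a b x : ℝ) : (-x * (x - a) * (x - b)) ^ 2
    ≤ 3 * (x ^ 6 + (a + b) ^ 2 * x ^ 4 + (a * b) ^ 2 * x ^ 2) := by
  have e : -x * (x - a) * (x - b) = -x ^ 3 + (a + b) * x ^ 2 - a * b * x := by ring
  rw [e]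
  nlinarith [sq_nonneg (-x ^ 3 - (a + b) * x ^ 2), sq_nonneg (-x ^ 3 + a * b * x),
    sq_nonneg ((a + b) * x ^ 2 + a * b * x)]


/-- The Nemytskii operator of the FitzHugh–Nagumo nonlinearity is η-quasi-dissipative
on `L²(O, μ)` along `L⁶` functions, with `η = (a² - a b + b²)/3`. -/
theorem fhn_nemytskii_quasi_dissipative (a b : ℝ) (p : ℝ → ℝ)
    (hp : ∀ v : ℝ, p v = -v * (v - a) * (v - b))
    (η : ℝ) (hη : η = (a ^ 2 - a * b + b ^ 2) / 3)
    (O : Type*) [MeasurableSpace O] (μ : Measure O) [IsFiniteMeasure μ] :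
    ∀ v₁ v₂ : O → ℝ, Measurable v₁ → Measurable v₂ →
      Integrable (fun ξ => |v₁ ξ| ^ 6) μ → Integrable (fun ξ => |v₂ ξ| ^ 6) μ →
      Integrable (fun ξ => (p (v₁ ξ) - p (v₂ ξ)) * (v₁ ξ - v₂ ξ)) μ ∧
      ∫ ξ, (p (v₁ ξ) - p (v₂ ξ)) * (v₁ ξ - v₂ ξ) ∂μ
        ≤ η * ∫ ξ, (v₁ ξ - v₂ ξ) ^ 2 ∂μ := by
  intro v₁ v₂ m₁ m₂ h₁ h₂
  obtain ⟨i₁, j₁, k₁⟩ := fhn_int_pow μ v₁ m₁ h₁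
  obtain ⟨i₂, j₂, k₂⟩ := fhn_int_pow μ v₂ m₂ h₂
  have hm : Measurable (fun ξ => (p (v₁ ξ) - p (v₂ ξ)) * (v₁ ξ - v₂ ξ)) := by
    simp only [hp]
    fun_prop
  have hI : Integrable (fun ξ => (p (v₁ ξ) - p (v₂ ξ)) * (v₁ ξ - v₂ ξ)) μ := by
    have B := (((((k₁.add (j₁.const_mul ((a + b) ^ 2))).add
      (i₁.const_mul ((a * b) ^ 2))).const_mul 3).add
      (((k₂.add (j₂.const_mul ((a + b) ^ 2))).add
      (i₂.const_mul ((a * b) ^ 2))).const_mul 3)).add i₁).add i₂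
    refine B.mono' hm.aestronglyMeasurable (Filter.Eventually.of_forall fun ξ => ?_)
    simp only [Pi.add_apply]
    have b₁ := fhn_sq_bound a b (v₁ ξ)
    have b₂ := fhn_sq_bound a b (v₂ ξ)
    rw [← hp] at b₁ b₂
    have key : ∀ P Q x y : ℝ, |(P - Q) * (x - y)| ≤ P ^ 2 + Q ^ 2 + x ^ 2 + y ^ 2 := by
      intro P Q x y
      rw [abs_le]
      constructor <;>
      nlinarith [sq_nonneg (P - Q - (x - y)), sq_nonneg (P - Q + (x - y)),
        sq_nonneg (P + Q), sq_nonneg (x + y)]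
    have := key (p (v₁ ξ)) (p (v₂ ξ)) (v₁ ξ) (v₂ ξ)
    rw [Real.norm_eq_abs]
    linarith
  refine ⟨hI, ?_⟩
  have hD : Integrable (fun ξ => (v₁ ξ - v₂ ξ) ^ 2) μ := by
    refine ((i₁.const_mul 2).add (i₂.const_mul 2)).mono'
      ((m₁.sub m₂).pow_const 2).aestronglyMeasurable (Filter.Eventually.of_forall fun ξ => ?_)
    simp only [Pi.add_apply]
    rw [Real.norm_of_nonneg (sq_nonneg _)]
    nlinarith [sq_nonneg (v₁ ξ + v₂ ξ)]
  rw [← integral_const_mul]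
  refine integral_mono hI (hD.const_mul η) fun ξ => ?_
  simp only [hp, hη]
  generalize v₁ ξ = x
  generalize v₂ ξ = y
  have e : (a ^ 2 - a * b + b ^ 2) / 3 * (x - y) ^ 2
      - (-x * (x - a) * (x - b) - -y * (y - a) * (y - b)) * (x - y)
      = (x - y) ^ 2 * ((x - y) ^ 2 / 4 + 3 / 4 * (x + y - 2 * (a + b) / 3) ^ 2) := by ring
  have : 0 ≤ (x - y) ^ 2 * ((x - y) ^ 2 / 4 + 3 / 4 * (x + y - 2 * (a + b) / 3) ^ 2) := by
    positivity
  linarith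
end

section
/- For any μ-square-integrable f : O → ℝ, any γ > 0, δ > 0, and any pairs X₁ = (v₁, w₁), X₂ = (v₂, w₂) with v₁, v₂ ∈ L⁶(O, μ) and w₁, w₂ ∈ L²(O, μ), the full FitzHugh–Nagumo drift B(v, w) := (p∘v − w + f, γ·v − δ·w) satisfies ⟨B(X₁) − B(X₂), X₁ − X₂⟩_H ≤ η·γ·‖v₁ − v₂‖²_{L²(μ)} − δ·‖w₁ − w₂‖²_{L²(μ)} ≤ η·‖X₁ − X₂‖²_H, where η = (a² − a·b + b²)/3. That is, the drift of the stochastic FitzHugh–Nagumo system is η-quasi-dissipative on H. -/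
open MeasureTheory

/-- Powers `v, v², v³` of an `L⁶` function on a finite measure space are in `L²`. -/
lemma fhn_memLp_p (a b : ℝ) (p : ℝ → ℝ) (hp : ∀ x : ℝ, p x = -x * (x - a) * (x - b))
    {O : Type*} [MeasurableSpace O] (μ : Measure O) [IsFiniteMeasure μ]
    (v : O → ℝ) (hv : Measurable v) (hv6 : Integrable (fun ξ => |v ξ| ^ 6) μ) :
    MemLp v 2 μ ∧ MemLp (fun ξ => p (v ξ)) 2 μ := by
  have e6 : ∀ x : ℝ, |x| ^ 6 = x ^ 6 := fun x => Even.pow_abs (by decide) x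
  simp only [e6] at hv6
  have hd : Integrable (fun ξ => 1 + v ξ ^ 6) μ := (integrable_const 1).add hv6
  have h1 : MemLp v 2 μ := by
    rw [memLp_two_iff_integrable_sq hv.aestronglyMeasurable]
    refine hd.mono' (by fun_prop) (Filter.Eventually.of_forall fun ξ => ?_)
    rw [Real.norm_of_nonneg (by positivity)]
    have ht : 0 ≤ v ξ ^ 2 := by positivity
    have : v ξ ^ 6 = (v ξ ^ 2) ^ 3 := by ring
    rw [this]
    generalize v ξ ^ 2 = t at ht
    nlinarith [mul_nonneg ht (sq_nonneg (t - 1)), sq_nonneg (t - 1)]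
  have h2 : MemLp (fun ξ => v ξ ^ 2) 2 μ := by
    rw [memLp_two_iff_integrable_sq (by fun_prop)]
    refine hd.mono' (by fun_prop) (Filter.Eventually.of_forall fun ξ => ?_)
    rw [Real.norm_of_nonneg (by positivity)]
    have ht : 0 ≤ v ξ ^ 2 := by positivity
    have : v ξ ^ 6 = (v ξ ^ 2) ^ 3 := by ring
    rw [this]
    generalize v ξ ^ 2 = t at ht
    nlinarith [mul_nonneg ht (sq_nonneg (t - 1)), sq_nonneg (t - 1)]
  have h3 : MemLp (fun ξ => v ξ ^ 3) 2 μ := by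
    rw [memLp_two_iff_integrable_sq (by fun_prop)]
    refine hv6.congr (Filter.Eventually.of_forall fun ξ => ?_)
    ring
  refine ⟨h1, ?_⟩
  have h := (h2.const_mul (a + b)).sub (h3.add (h1.const_mul (a * b)))
  refine (memLp_congr_ae (Filter.Eventually.of_forall fun ξ => ?_)).mp h
  simp only [hp, Pi.sub_apply, Pi.add_apply]
  ring

/-- The full FitzHugh–Nagumo drift `B (v, w) = (p∘v - w + f, γ v - δ w)` is
η-quasi-dissipative on `H = L²(O,μ) × L²(O,μ)` endowed with the weighted inner product
`⟨(v₁,w₁),(v₂,w₂)⟩_H = γ ∫ v₁ v₂ dμ + ∫ w₁ w₂ dμ`, with `η = (a² - a b + b²)/3`: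
`⟨B X₁ - B X₂, X₁ - X₂⟩_H ≤ η γ ‖v₁ - v₂‖²_{L²} - δ ‖w₁ - w₂‖²_{L²} ≤ η ‖X₁ - X₂‖²_H`. -/
theorem fhn_full_drift_quasi_dissipative (a b γ δ : ℝ) (hγ : 0 < γ) (hδ : 0 < δ)
    (p : ℝ → ℝ) (hp : ∀ x : ℝ, p x = -x * (x - a) * (x - b))
    (η : ℝ) (hη : η = (a ^ 2 - a * b + b ^ 2) / 3)
    (O : Type*) [MeasurableSpace O] (μ : Measure O) [IsFiniteMeasure μ]
    (f : O → ℝ) (hfm : Measurable f) (hf : Integrable (fun ξ => (f ξ) ^ 2) μ)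
    (v₁ w₁ v₂ w₂ : O → ℝ)
    (hv₁ : Measurable v₁) (hv₂ : Measurable v₂) (hw₁ : Measurable w₁) (hw₂ : Measurable w₂)
    (hv₁6 : Integrable (fun ξ => |v₁ ξ| ^ 6) μ) (hv₂6 : Integrable (fun ξ => |v₂ ξ| ^ 6) μ)
    (hw₁2 : Integrable (fun ξ => (w₁ ξ) ^ 2) μ) (hw₂2 : Integrable (fun ξ => (w₂ ξ) ^ 2) μ) :
    γ * ∫ ξ, ((p (v₁ ξ) - w₁ ξ + f ξ) - (p (v₂ ξ) - w₂ ξ + f ξ)) * (v₁ ξ - v₂ ξ) ∂μ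
        + ∫ ξ, ((γ * v₁ ξ - δ * w₁ ξ) - (γ * v₂ ξ - δ * w₂ ξ)) * (w₁ ξ - w₂ ξ) ∂μ
      ≤ η * γ * ∫ ξ, (v₁ ξ - v₂ ξ) ^ 2 ∂μ - δ * ∫ ξ, (w₁ ξ - w₂ ξ) ^ 2 ∂μ ∧
    η * γ * ∫ ξ, (v₁ ξ - v₂ ξ) ^ 2 ∂μ - δ * ∫ ξ, (w₁ ξ - w₂ ξ) ^ 2 ∂μ
      ≤ η * (γ * ∫ ξ, (v₁ ξ - v₂ ξ) ^ 2 ∂μ + ∫ ξ, (w₁ ξ - w₂ ξ) ^ 2 ∂μ) := by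
  obtain ⟨mv₁, mp₁⟩ := fhn_memLp_p a b p hp μ v₁ hv₁ hv₁6
  obtain ⟨mv₂, mp₂⟩ := fhn_memLp_p a b p hp μ v₂ hv₂ hv₂6
  have mw₁ : MemLp w₁ 2 μ := (memLp_two_iff_integrable_sq hw₁.aestronglyMeasurable).2 hw₁2
  have mw₂ : MemLp w₂ 2 μ := (memLp_two_iff_integrable_sq hw₂.aestronglyMeasurable).2 hw₂2
  have mv := mv₁.sub mv₂
  have mw := mw₁.sub mw₂
  have mp := mp₁.sub mp₂
  have iF : Integrable (fun ξ => ((p (v₁ ξ) - w₁ ξ + f ξ) - (p (v₂ ξ) - w₂ ξ + f ξ))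
      * (v₁ ξ - v₂ ξ)) μ := by
    refine ((mp.sub mw).integrable_mul mv).congr (Filter.Eventually.of_forall fun ξ => ?_)
    simp only [Pi.mul_apply, Pi.sub_apply]
    ring
  have iG : Integrable (fun ξ => ((γ * v₁ ξ - δ * w₁ ξ) - (γ * v₂ ξ - δ * w₂ ξ))
      * (w₁ ξ - w₂ ξ)) μ := by
    refine (((mv.const_mul γ).sub (mw.const_mul δ)).integrable_mul mw).congr
      (Filter.Eventually.of_forall fun ξ => ?_)
    simp only [Pi.mul_apply, Pi.sub_apply]
    ring
  have iV : Integrable (fun ξ => (v₁ ξ - v₂ ξ) ^ 2) μ := mv.integrable_sq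
  have iW : Integrable (fun ξ => (w₁ ξ - w₂ ξ) ^ 2) μ := mw.integrable_sq
  have hη0 : 0 ≤ η := by
    rw [hη]
    nlinarith [sq_nonneg (a - b), sq_nonneg a, sq_nonneg b]
  constructor
  · rw [← integral_const_mul, ← integral_const_mul, ← integral_const_mul,
      ← integral_add (iF.const_mul γ) iG, ← integral_sub (iV.const_mul _) (iW.const_mul _)]
    refine integral_mono ((iF.const_mul γ).add iG) ((iV.const_mul _).sub (iW.const_mul _)) ?_
    intro ξ
    simp only [hp, hη, Pi.add_apply, Pi.sub_apply]
    generalize v₁ ξ = x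
    generalize v₂ ξ = y
    have key : 0 ≤ (a ^ 2 - a * b + b ^ 2) / 3
        + (x ^ 2 + x * y + y ^ 2) - (a + b) * (x + y) + a * b := by
      nlinarith [sq_nonneg (x - y), sq_nonneg (3 * (x + y) - 2 * (a + b))]
    have := mul_nonneg hγ.le (mul_nonneg (sq_nonneg (x - y)) key)
    linarith
  · have : 0 ≤ ∫ ξ, (w₁ ξ - w₂ ξ) ^ 2 ∂μ := integral_nonneg fun ξ => sq_nonneg _
    nlinarith [mul_nonneg hη0 this, mul_nonneg hδ.le this]
end
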